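/- A finite simple graph G on n vertices has no even cycle if and only if for every orientation \sigma of G, the characteristic polynomial of the skew-adjacency matrix S(G^\sigma) satisfies \phi_s(G^\sigma, x) = (-i)^n m(G, ix), where m(G, x) is the matching polynomial of G. -/

import Mathlib

open Polynomial

/-- Number of matchings with exactly `k` edges in `G`. -/
noncomputable def matchingCount {V : Type*} [Fintype V] (G : SimpleGraph V) (k : ℕ) : ℕ :=
  Nat.card {s : Finset (Sym2 V) // s.card = k ∧ (∀ e ∈ s, e ∈ G.edgeSet) ∧
    ∀ e ∈ s, ∀ f ∈ s, e ≠ f → ∀ x : V, x ∈ e → x ∉ f}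

/-- The matching polynomial `m(G,x) = ∑ (-1)^k m_k(G) x^(n-2k)`. -/
noncomputable def matchPoly {V : Type*} [Fintype V] (G : SimpleGraph V) : Polynomial ℝ :=
  ∑ k ∈ Finset.range (Fintype.card V + 1),
    Polynomial.C ((-1 : ℝ) ^ k * (matchingCount G k : ℝ)) *
      Polynomial.X ^ (Fintype.card V - 2 * k)

/-- The maximum real root `t(G)` of the matching polynomial. -/
noncomputable def maxRoot {V : Type*} [Fintype V] (G : SimpleGraph V) : ℝ :=
  sSup {x : ℝ | (matchPoly G).eval x = 0}

/-- The skew-adjacency matrix of the orientation `o` (where `o a b = true` means `a → b`). -/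
def skewMatrix {V : Type*} (o : V → V → Bool) : Matrix V V ℝ :=
  fun a b => if o a b then 1 else if o b a then -1 else 0

set_option linter.unusedSectionVars false

section aux

open Equiv Equiv.Perm

variable {V : Type*} [Fintype V] [DecidableEq V]

/-- The signed weight of a permutation in the expansion of the characteristic polynomial. -/
noncomputable def permWt (S : Matrix V V ℝ) (σ : Perm V) : ℝ :=
  ((sign σ : ℤ) : ℝ) * ∏ v ∈ σ.support, -S (σ v) v

lemma charpoly_eq_sum_permWt (S : Matrix V V ℝ) (hd : ∀ v, S v v = 0) :
    S.charpoly = ∑ σ : Perm V, C (permWt S σ) * X ^ (Fintype.card V - σ.support.card) := by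
  rw [Matrix.charpoly, Matrix.det_apply']
  refine Finset.sum_congr rfl fun σ _ => ?_
  have h1 : ∏ v, S.charmatrix (σ v) v
      = (∏ v ∈ σ.support, S.charmatrix (σ v) v) * ∏ v ∈ σ.supportᶜ, S.charmatrix (σ v) v :=
    (Finset.prod_mul_prod_compl _ _).symm
  have h2 : ∏ v ∈ σ.support, S.charmatrix (σ v) v = C (∏ v ∈ σ.support, -S (σ v) v) := by
    rw [map_prod]
    refine Finset.prod_congr rfl fun v hv => ?_
    rw [Matrix.charmatrix_apply_ne _ _ _ (mem_support.1 hv)]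
    simp
  have h3 : ∏ v ∈ σ.supportᶜ, S.charmatrix (σ v) v = X ^ (Fintype.card V - σ.support.card) := by
    rw [← Finset.card_compl, ← Finset.prod_const]
    refine Finset.prod_congr rfl fun v hv => ?_
    have : σ v = v := by simpa using hv
    rw [this, Matrix.charmatrix_apply_eq, hd]
    simp
  rw [h1, h2, h3, permWt]
  simp [mul_assoc]

lemma coeff_charpoly_eq (S : Matrix V V ℝ) (hd : ∀ v, S v v = 0) (l : ℕ)
    (hl : l ≤ Fintype.card V) :
    S.charpoly.coeff (Fintype.card V - l)
      = ∑ σ ∈ Finset.univ.filter (fun σ : Perm V => σ.support.card = l), permWt S σ := by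
  rw [charpoly_eq_sum_permWt S hd, finsetSum_coeff, Finset.sum_filter]
  refine Finset.sum_congr rfl fun σ _ => ?_
  rw [coeff_C_mul, coeff_X_pow]
  have := Finset.card_le_univ σ.support
  have e : (Fintype.card V - l = Fintype.card V - σ.support.card) ↔ σ.support.card = l := by omega
  simp [e]

lemma permWt_mul (S : Matrix V V ℝ) {σ τ : Perm V} (h : Perm.Disjoint σ τ) :
    permWt S (σ * τ) = permWt S σ * permWt S τ := by
  unfold permWt
  rw [h.support_mul, Finset.prod_union h.disjoint_support, Perm.sign_mul]
  have h1 : ∏ v ∈ σ.support, -S ((σ * τ) v) v = ∏ v ∈ σ.support, -S (σ v) v := by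
    refine Finset.prod_congr rfl fun v hv => ?_
    have : τ v = v := (h v).resolve_left (mem_support.1 hv)
    simp [this]
  have h2 : ∏ v ∈ τ.support, -S ((σ * τ) v) v = ∏ v ∈ τ.support, -S (τ v) v := by
    refine Finset.prod_congr rfl fun v hv => ?_
    have : σ v = v := (h v).resolve_right (mem_support.1 hv)
    rw [h.commute.eq]
    simp [this]
  rw [h1, h2]
  push_cast
  ring

lemma permWt_inv (S : Matrix V V ℝ) (hS : ∀ a b, S a b = - S b a) (σ : Perm V) :
    permWt S σ⁻¹ = (-1) ^ σ.support.card * permWt S σ := by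
  unfold permWt
  rw [sign_inv, support_inv]
  have : ∏ v ∈ σ.support, -S (σ⁻¹ v) v = ∏ v ∈ σ.support, (-1) * -S (σ v) v := by
    symm
    refine Finset.prod_bij (fun v _ => σ v) (fun v hv => by simpa using hv)
      (fun a _ b _ h => σ.injective h)
      (fun b hb => ⟨σ⁻¹ b, by
        rw [← support_inv, apply_mem_support, support_inv]; exact hb, by simp⟩)
      (fun v hv => ?_)
    have hi : σ⁻¹ (σ v) = v := by simp
    rw [hi]
    rw [hS v]; ring
  rw [this, Finset.prod_mul_distrib, Finset.prod_const]
  ring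

lemma permWt_invol (S : Matrix V V ℝ) (hS : ∀ a b, S a b = - S b a) (σ : Perm V)
    (h2 : ∀ v, σ (σ v) = v) (h1 : ∀ v ∈ σ.support, S (σ v) v * S (σ v) v = 1) :
    permWt S σ = 1 := by
  induction σ using cycle_induction_on with
  | base_one => simp [permWt]
  | base_cycles σ hσ =>
    obtain ⟨x, hx, -⟩ := id hσ
    have : σ = swap x (σ x) := hσ.eq_swap_of_apply_apply_eq_self hx (h2 x)
    have hs : σ.support = {x, σ x} := by
      conv_lhs => rw [this]
      exact support_swap (Ne.symm hx)
    have hsg : sign σ = -1 := by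
      rw [this]; exact sign_swap (Ne.symm hx)
    unfold permWt
    rw [hs, Finset.prod_pair (Ne.symm hx), hsg, h2 x]
    have := h1 x (mem_support.2 hx)
    rw [hS x]
    push_cast
    linarith
  | induction_disjoint σ τ hd hc ih1 ih2 =>
    rw [permWt_mul S hd, ih1 ?_ ?_, ih2 ?_ ?_, one_mul]
    · intro v
      by_cases hv : τ v = v
      · rw [hv, hv]
      have hs : σ v = v := (hd v).resolve_right hv
      have hs' : σ (τ v) = τ v := (hd _).resolve_right (fun h => hv (τ.injective h))
      have hs'' : σ (τ (τ v)) = τ (τ v) :=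
        (hd _).resolve_right (fun h => hv (τ.injective (τ.injective h)))
      have := h2 v
      simp only [Perm.mul_apply] at this
      rw [hs', hs''] at this
      exact this
    · intro v hv
      have hs : σ (τ v) = τ v :=
        (hd _).resolve_right (fun h => (mem_support.1 hv) (τ.injective h))
      have := h1 v (by rw [hd.support_mul]; exact Finset.mem_union_right _ hv)
      simpa [hs] using this
    · intro v
      by_cases hv : σ v = v
      · rw [hv, hv]
      have hs : τ v = v := (hd v).resolve_left hv
      have hs' : τ (σ v) = σ v := (hd _).resolve_left (fun h => hv (σ.injective h))
      have := h2 v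
      simp only [Perm.mul_apply] at this
      rw [hs, hs'] at this
      exact this
    · intro v hv
      have hs : τ v = v := (hd _).resolve_left (mem_support.1 hv)
      have := h1 v (by rw [hd.support_mul]; exact Finset.mem_union_left _ hv)
      simpa [hs] using this

lemma exists_walk_of_seq (G : SimpleGraph V) (f : ℕ → V) (n : ℕ)
    (h : ∀ i < n, G.Adj (f i) (f (i + 1))) :
    ∃ p : G.Walk (f 0) (f n), p.length = n ∧ p.support = (List.range (n + 1)).map f := by
  induction n with
  | zero => exact ⟨.nil, rfl, by simp⟩
  | succ n ih =>
    obtain ⟨p, hp, hs⟩ := ih (fun i hi => h i (by omega))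
    refine ⟨p.concat (h n (by omega)), by simp [hp], ?_⟩
    rw [SimpleGraph.Walk.support_concat, hs, List.range_succ (n := n + 1)]
    simp

lemma exists_cycle_of_perm (G : SimpleGraph V) (c : Perm V) (hc : c.IsCycle)
    (h3 : 3 ≤ c.support.card) (hadj : ∀ v ∈ c.support, G.Adj v (c v)) :
    ∃ (u : V) (p : G.Walk u u), p.IsCycle ∧ p.length = c.support.card := by
  obtain ⟨x, hx, -⟩ := id hc
  have ho : orderOf c = c.support.card := hc.orderOf
  have hmem : ∀ i : ℕ, (c ^ i) x ∈ c.support := fun i => by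
    rw [pow_apply_mem_support]; exact mem_support.2 hx
  obtain ⟨n, hn⟩ : ∃ n, c.support.card = n + 1 := ⟨c.support.card - 1, by omega⟩
  obtain ⟨p, hp, hs⟩ := exists_walk_of_seq G (fun i => (c ^ (i + 1)) x) n (fun i _ => by
    have := hadj _ (hmem (i + 1))
    rwa [← Perm.mul_apply, ← pow_succ'] at this)
  have hend : (c ^ (n + 1)) x = x := by rw [← hn, ← ho, pow_orderOf_eq_one]; rfl
  have hinj : ∀ i j, i < n + 1 → j < n + 1 → (c ^ (i + 1)) x = (c ^ (j + 1)) x → i = j := by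
    intro i j hi hj h
    have h' : (c ^ i) x = (c ^ j) x := by
      apply c.injective
      rw [← Perm.mul_apply, ← Perm.mul_apply, ← pow_succ', ← pow_succ']; exact h
    have := (hc.pow_eq_pow_iff).2 ⟨x, hx, h'⟩
    exact pow_injOn_Iio_orderOf (by simp; omega) (by simp; omega) this
  have hpath : p.IsPath := by
    rw [SimpleGraph.Walk.isPath_def, hs]
    refine List.Nodup.map_on ?_ List.nodup_range
    intro i hi j hj h
    exact hinj i j (by simpa using hi) (by simpa using hj) h
  have ha : G.Adj ((c ^ (n + 1)) x) ((c ^ (0 + 1)) x) := by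
    rw [hend]; simpa using hadj x (mem_support.2 hx)
  refine ⟨_, SimpleGraph.Walk.cons ha p, ?_, by simp [hp, hn]⟩
  rw [SimpleGraph.Walk.isCycle_iff_isPath_tail_and_le_length]
  refine ⟨?_, ?_⟩
  · simpa using hpath
  · simp [hp]; omega

lemma exists_perm_of_cycle (G : SimpleGraph V) (u : V) (p : G.Walk u u) (hp : p.IsCycle) :
    ∃ c : Perm V, c.IsCycle ∧ c.support.card = p.length ∧ ∀ v ∈ c.support, G.Adj v (c v) := by
  have h3 := hp.three_le_length
  have hnd : p.support.tail.Nodup := hp.support_nodup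
  have hlen : p.support.tail.length = p.length := by simp
  have hne : ∀ x : V, p.support.tail ≠ [x] := by
    intro x hx; rw [hx] at hlen; simp at hlen; omega
  have hsupp := List.support_formPerm_of_nodup _ hnd hne
  refine ⟨p.support.tail.formPerm, List.isCycle_formPerm hnd (by omega), ?_, ?_⟩
  · rw [hsupp, List.toFinset_card_of_nodup hnd, hlen]
  · intro v hv
    rw [hsupp, List.mem_toFinset] at hv
    obtain ⟨i, hi, rfl⟩ := List.getElem_of_mem hv
    rw [List.formPerm_apply_getElem _ hnd]
    have hg : ∀ j (hj : j < p.support.tail.length), p.support.tail[j] = p.getVert (j + 1) := by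
      intro j hj
      rw [List.getElem_tail, p.support_getElem_eq_getVert]
    rw [hg, hg]
    rw [hlen] at hi
    simp only [hlen]
    by_cases h : i + 1 = p.length
    · rw [h, Nat.mod_self]
      have := p.adj_getVert_succ (i := 0) (by omega)
      simpa using this
    · rw [Nat.mod_eq_of_lt (by omega)]
      exact p.adj_getVert_succ (by omega)

/-- The set of edges traversed by a permutation. -/
def permEdges (σ : Perm V) : Finset (Sym2 V) := σ.support.image (fun v => s(v, σ v))

lemma invol_edge_eq {σ : Perm V} (h : ∀ v, σ (σ v) = v) {x v : V} (hx : x ∈ s(v, σ v)) :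
    s(x, σ x) = s(v, σ v) := by
  rw [Sym2.mem_iff] at hx
  rcases hx with rfl | rfl
  · rfl
  · rw [h, Sym2.eq_swap]

lemma card_support_invol {σ : Perm V} (h : ∀ v, σ (σ v) = v) :
    σ.support.card = 2 * (permEdges σ).card := by
  unfold permEdges
  rw [Finset.card_eq_sum_card_image (fun v => s(v, σ v)) σ.support]
  rw [Finset.sum_const_nat (m := 2), mul_comm]
  intro e he
  obtain ⟨v, hv, rfl⟩ := Finset.mem_image.1 he
  have : σ.support.filter (fun x => s(x, σ x) = s(v, σ v)) = {v, σ v} := by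
    ext x
    simp only [Finset.mem_filter, Finset.mem_insert, Finset.mem_singleton]
    constructor
    · rintro ⟨-, hx⟩
      have : x ∈ s(v, σ v) := by rw [← hx]; simp
      simpa using this
    · intro hx
      refine ⟨?_, invol_edge_eq h (by simpa using hx)⟩
      rcases hx with rfl | rfl
      · exact hv
      · exact apply_mem_support.2 hv
  rw [this, Finset.card_pair (Ne.symm (mem_support.1 hv))]

lemma invol_eq_of_edges {σ τ : Perm V} (ht : ∀ v, τ (τ v) = v)
    (h : permEdges σ ⊆ permEdges τ) (v : V) (hv : v ∈ σ.support) : σ v = τ v := by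
  have h1 : s(v, σ v) ∈ permEdges τ := h (Finset.mem_image_of_mem _ hv)
  obtain ⟨w, hw, hwe⟩ := Finset.mem_image.1 h1
  have h2 : v ∈ s(w, τ w) := by rw [hwe]; simp
  have h3 := invol_edge_eq ht h2
  rw [hwe] at h3
  exact (Sym2.congr_right.1 h3).symm

lemma matchingCount_eq (G : SimpleGraph V) (k : ℕ) :
    matchingCount G k = Nat.card {σ : Perm V // ((∀ v, σ (σ v) = v) ∧
      (∀ v ∈ σ.support, G.Adj (σ v) v)) ∧ σ.support.card = 2 * k} := by
  unfold matchingCount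
  symm
  refine Nat.card_congr (Equiv.ofBijective (fun σ => ⟨permEdges σ.1, ?_, ?_, ?_⟩) ⟨?_, ?_⟩)
  · have := card_support_invol σ.2.1.1
    have := σ.2.2
    omega
  · intro e he
    obtain ⟨v, hv, rfl⟩ := Finset.mem_image.1 he
    exact (σ.2.1.2 v hv).symm
  · intro e he f hf hef x hxe hxf
    obtain ⟨v, hv, rfl⟩ := Finset.mem_image.1 he
    obtain ⟨w, hw, rfl⟩ := Finset.mem_image.1 hf
    exact hef ((invol_edge_eq σ.2.1.1 hxe).symm.trans (invol_edge_eq σ.2.1.1 hxf))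
  · intro σ τ h
    have he : permEdges σ.1 = permEdges τ.1 := congrArg Subtype.val h
    apply Subtype.ext
    ext v
    by_cases hv : v ∈ σ.1.support
    · exact invol_eq_of_edges τ.2.1.1 he.subset v hv
    by_cases hv' : v ∈ τ.1.support
    · exact (invol_eq_of_edges σ.2.1.1 he.symm.subset v hv').symm
    · rw [notMem_support.1 hv, notMem_support.1 hv']
  · rintro ⟨s, hk, hG, hm⟩
    classical
    have huniq : ∀ v w w', s(v, w) ∈ s → s(v, w') ∈ s → w = w' := by
      intro v w w' h1 h2
      by_contra hne
      exact hm _ h1 _ h2 (fun h => hne (Sym2.congr_right.1 h)) v (by simp) (by simp)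
    let f : V → V := fun v => if h : ∃ w, s(v, w) ∈ s then h.choose else v
    have hf1 : ∀ v w, s(v, w) ∈ s → f v = w := by
      intro v w h
      have hex : ∃ w, s(v, w) ∈ s := ⟨w, h⟩
      have : f v = hex.choose := dif_pos hex
      rw [this]
      exact huniq v _ _ hex.choose_spec h
    have hf2 : ∀ v, f v ≠ v → s(v, f v) ∈ s := by
      intro v hv
      by_cases hex : ∃ w, s(v, w) ∈ s
      · obtain ⟨w, hw⟩ := hex
        rw [hf1 v w hw]; exact hw
      · exact absurd (dif_neg hex) hv
    have hinv : Function.Involutive f := by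
      intro v
      by_cases hv : f v = v
      · rw [hv, hv]
      · exact hf1 _ _ (by rw [Sym2.eq_swap]; exact hf2 v hv)
    let σ : Perm V := hinv.toPerm f
    have hσ : ∀ v, σ v = f v := fun v => rfl
    have hσ2 : ∀ v, σ (σ v) = v := hinv
    have he : permEdges σ = s := by
      ext e
      constructor
      · intro he
        obtain ⟨v, hv, rfl⟩ := Finset.mem_image.1 he
        exact hf2 v (mem_support.1 hv)
      · induction e with
        | _ a b =>
          intro he
          have hab : G.Adj a b := hG _ he
          have hfa : σ a = b := hf1 a b he
          refine Finset.mem_image.2 ⟨a, ?_, by rw [hfa]⟩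
          rw [mem_support, hfa]
          exact hab.ne.symm
    refine ⟨⟨σ, ⟨hσ2, ?_⟩, ?_⟩, Subtype.ext he⟩
    · intro v hv
      have : G.Adj v (f v) := hG _ (hf2 v (mem_support.1 hv))
      exact this.symm
    · rw [card_support_invol hσ2, he, hk]

lemma matchingCount_eq_zero (G : SimpleGraph V) (k : ℕ) (hk : Fintype.card V < 2 * k) :
    matchingCount G k = 0 := by
  rw [matchingCount_eq, Nat.card_eq_zero]
  left
  constructor
  rintro ⟨σ, -, h⟩
  have := Finset.card_le_univ σ.support
  omega

/-- The all-positive version of the matching polynomial. -/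
noncomputable def posMatch (G : SimpleGraph V) : Polynomial ℝ :=
  ∑ k ∈ Finset.range (Fintype.card V + 1),
    C (matchingCount G k : ℝ) * X ^ (Fintype.card V - 2 * k)

lemma rhs_eq (G : SimpleGraph V) :
    Polynomial.C ((-Complex.I) ^ Fintype.card V) *
            ((matchPoly G).map (algebraMap ℝ ℂ)).comp
              (Polynomial.C Complex.I * Polynomial.X) = (posMatch G).map (algebraMap ℝ ℂ) := by
  unfold matchPoly posMatch
  rw [Polynomial.map_sum, Polynomial.map_sum, Polynomial.sum_comp, Finset.mul_sum]
  refine Finset.sum_congr rfl fun k _ => ?_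
  by_cases hk : Fintype.card V < 2 * k
  · simp [matchingCount_eq_zero G k hk]
  · obtain ⟨m, hm⟩ : ∃ m, Fintype.card V = 2 * k + m := ⟨Fintype.card V - 2 * k, by omega⟩
    have e : Fintype.card V - 2 * k = m := by omega
    rw [e, hm]
    simp only [Polynomial.map_mul, Polynomial.map_C, Polynomial.map_pow, Polynomial.map_X,
      Polynomial.mul_comp, Polynomial.C_comp, Polynomial.pow_comp, Polynomial.X_comp, mul_pow]
    rw [← C_pow, ← mul_assoc, ← mul_assoc, ← C_mul, ← C_mul]
    congr 2
    have h1 : (-Complex.I) ^ m * Complex.I ^ m = 1 := by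
      rw [← mul_pow]; simp
    have h2 : (-Complex.I) ^ (2 * k) = (-1) ^ k := by
      rw [pow_mul]; simp
    have h3 : ((-1 : ℂ) ^ k) * (-1) ^ k = 1 := by
      rw [← mul_pow]; simp
    rw [pow_add, h2]
    simp only [map_mul, map_pow, map_neg, map_one, map_natCast]
    linear_combination (matchingCount G k : ℂ) * ((-Complex.I) ^ m * Complex.I ^ m) * h3 +
      (matchingCount G k : ℂ) * h1

lemma posMatch_eq (G : SimpleGraph V) [DecidableRel G.Adj] :
    posMatch G = ∑ σ : {σ : Perm V // (∀ v, σ (σ v) = v) ∧ (∀ v ∈ σ.support, G.Adj (σ v) v)},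
      (X : Polynomial ℝ) ^ (Fintype.card V - σ.1.support.card) := by
  classical
  have hmaps : ∀ σ ∈ (Finset.univ : Finset {σ : Perm V // (∀ v, σ (σ v) = v) ∧
      (∀ v ∈ σ.support, G.Adj (σ v) v)}), (permEdges σ.1).card ∈
        Finset.range (Fintype.card V + 1) := by
    intro σ _
    have h1 := card_support_invol σ.2.1
    have := Finset.card_le_univ σ.1.support
    rw [Finset.mem_range]; omega
  rw [← Finset.sum_fiberwise_of_maps_to hmaps]
  unfold posMatch
  refine Finset.sum_congr rfl fun k _ => ?_
  have : ∀ σ ∈ (Finset.univ : Finset {σ : Perm V // (∀ v, σ (σ v) = v) ∧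
      (∀ v ∈ σ.support, G.Adj (σ v) v)}).filter (fun σ => (permEdges σ.1).card = k),
      (X : Polynomial ℝ) ^ (Fintype.card V - σ.1.support.card)
        = X ^ (Fintype.card V - 2 * k) := by
    intro σ hσ
    rw [card_support_invol σ.2.1, (Finset.mem_filter.1 hσ).2]
  rw [Finset.sum_congr rfl this, Finset.sum_const, nsmul_eq_mul, matchingCount_eq]
  congr 1
  rw [← Fintype.card_subtype, ← Nat.card_eq_fintype_card]
  rw [map_natCast]
  congr 1
  refine Nat.card_congr ((Equiv.subtypeSubtypeEquivSubtypeInter _ _).symm.trans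
    (Equiv.subtypeEquivRight ?_))
  intro σ
  have := card_support_invol σ.2.1
  omega

lemma noninvol_sum (G : SimpleGraph V) (S : Matrix V V ℝ) (hS : ∀ a b, S a b = - S b a)
    (hadj : ∀ a b, S a b ≠ 0 → G.Adj a b)
    (hG : ∀ (u : V) (c : G.Walk u u), c.IsCycle → ¬ Even c.length) :
    ∑ σ : {σ : Perm V // ¬ ∀ v, σ (σ v) = v},
      C (permWt S σ.1) * X ^ (Fintype.card V - σ.1.support.card) = 0 := by
  classical
  let A : Perm V → Set V := fun σ => {v | σ (σ v) ≠ v}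
  have hA : ∀ σ : {σ : Perm V // ¬ ∀ v, σ (σ v) = v}, ∃ v, v ∈ A σ.1 := fun σ =>
    not_forall.1 σ.2
  let pick : Set V → Perm V → V → V := fun B _ d => if h : ∃ v, v ∈ B then h.choose else d
  have hpick : ∀ (B : Set V) σ d (h : ∃ v, v ∈ B), pick B σ d = h.choose :=
    fun B σ d h => dif_pos h
  let v0 : {σ : Perm V // ¬ ∀ v, σ (σ v) = v} → V := fun σ => (hA σ).choose
  have hv0 : ∀ σ, σ.1 (σ.1 (v0 σ)) ≠ v0 σ := fun σ => (hA σ).choose_spec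
  have hv0' : ∀ σ, σ.1 (v0 σ) ≠ v0 σ := fun σ h => hv0 σ (by rw [h, h])
  have hv0_eq : ∀ σ τ, A σ.1 = A τ.1 → v0 σ = v0 τ := by
    intro σ τ h
    have := hpick (A σ.1) σ.1 (v0 σ) (hA σ)
    have h' := hpick (A τ.1) σ.1 (v0 σ) (hA τ)
    change _ = v0 σ at this
    change _ = v0 τ at h'
    rw [← this, ← h', h]
  let c : {σ : Perm V // ¬ ∀ v, σ (σ v) = v} → Perm V := fun σ => σ.1.cycleOf (v0 σ)
  have hc : ∀ σ, (c σ).IsCycle := fun σ => isCycle_cycleOf _ (hv0' σ)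
  let d : {σ : Perm V // ¬ ∀ v, σ (σ v) = v} → Perm V := fun σ => σ.1 * (c σ)⁻¹
  have hdc : ∀ σ, d σ * c σ = σ.1 := fun σ => by simp [d]
  have hdis : ∀ σ, Perm.Disjoint (d σ) (c σ) := fun σ =>
    disjoint_mul_inv_of_mem_cycleFactorsFinset
      (cycleOf_mem_cycleFactorsFinset_iff.2 (mem_support.2 (hv0' σ)))
  have hdis' : ∀ σ, Perm.Disjoint (d σ) (c σ)⁻¹ := fun σ => (hdis σ).inv_right
  have hsq : ∀ (d c : Perm V), Perm.Disjoint d c → ∀ v,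
      ((d * c) ((d * c) v) = v ↔ d (d v) = v ∧ c (c v) = v) := by
    intro d c h v
    have h1 : Perm.Disjoint (d ^ 2) (c ^ 2) := h.pow_disjoint_pow 2 2
    have h2 := h1.mul_apply_eq_iff (a := v)
    rw [← h.commute.mul_pow] at h2
    simpa [pow_two] using h2
  have hinvsq : ∀ (c : Perm V) v, (c⁻¹ (c⁻¹ v) = v ↔ c (c v) = v) := by
    intro c v
    rw [Perm.inv_eq_iff_eq, Perm.inv_eq_iff_eq]
    exact eq_comm
  have hAeq : ∀ σ, A (d σ * (c σ)⁻¹) = A σ.1 := by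
    intro σ
    ext v
    change ¬ _ ↔ ¬ _
    conv_rhs => rw [← hdc σ]
    rw [hsq _ _ (hdis' σ), hsq _ _ (hdis σ), hinvsq]
  let g : {σ : Perm V // ¬ ∀ v, σ (σ v) = v} → {σ : Perm V // ¬ ∀ v, σ (σ v) = v} :=
    fun σ => ⟨d σ * (c σ)⁻¹, by
      intro h
      have : v0 σ ∈ A (d σ * (c σ)⁻¹) := by rw [hAeq]; exact hv0 σ
      exact this (h _)⟩
  have hgv : ∀ σ, v0 (g σ) = v0 σ := fun σ => hv0_eq _ _ (hAeq σ)
  have hcv : ∀ σ, c σ (v0 σ) = σ.1 (v0 σ) := fun σ => cycleOf_apply_self _ _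
  have hdv : ∀ σ, d σ (v0 σ) = v0 σ := fun σ =>
    ((hdis σ) (v0 σ)).resolve_right (by rw [hcv]; exact hv0' σ)
  have hgc : ∀ σ, c (g σ) = (c σ)⁻¹ := by
    intro σ
    change (d σ * (c σ)⁻¹).cycleOf (v0 (g σ)) = _
    rw [hgv, (hdis' σ).cycleOf_mul_distrib, (cycleOf_eq_one_iff _).2 (hdv σ), one_mul]
    refine (hc σ).inv.cycleOf_eq ?_
    rw [Ne, Perm.inv_eq_iff_eq, hcv]
    exact (hv0' σ).symm
  have hgd : ∀ σ, d (g σ) = d σ := by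
    intro σ
    change (d σ * (c σ)⁻¹) * (c (g σ))⁻¹ = _
    rw [hgc]; simp
  have hgg : ∀ σ, g (g σ) = σ := by
    intro σ
    apply Subtype.ext
    change d (g σ) * (c (g σ))⁻¹ = _
    rw [hgc, hgd, inv_inv, hdc]
  have hsum : ∀ σ, permWt S σ.1 + permWt S (g σ).1 = 0 := by
    intro σ
    have h1 : permWt S σ.1 = permWt S (d σ) * permWt S (c σ) := by
      rw [← permWt_mul S (hdis σ), hdc]
    have h2 : permWt S (g σ).1 = (-1) ^ (c σ).support.card * permWt S σ.1 := by
      change permWt S (d σ * (c σ)⁻¹) = _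
      rw [permWt_mul S (hdis' σ), permWt_inv S hS, h1]; ring
    rcases Nat.even_or_odd (c σ).support.card with he | ho
    · have h0 : permWt S (c σ) = 0 := by
        by_contra hne
        have hprod : ∀ v ∈ (c σ).support, G.Adj v (c σ v) := by
          intro v hv
          refine (hadj _ _ ?_).symm
          intro h0
          apply hne
          unfold permWt
          rw [Finset.prod_eq_zero hv (by rw [h0]; simp), mul_zero]
        have h3 : 3 ≤ (c σ).support.card := by
          by_contra hlt
          have h2' := (hc σ).two_le_card_support
          have h2c : (c σ).support.card = 2 := by omega
          have ho : (c σ) ^ 2 = 1 := by rw [← h2c, ← (hc σ).orderOf, pow_orderOf_eq_one]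
          have hcc : c σ (c σ (v0 σ)) = v0 σ := by
            rw [← Perm.mul_apply, ← pow_two, ho]; rfl
          have := (hsq _ _ (hdis σ) (v0 σ)).2 ⟨by rw [hdv, hdv], hcc⟩
          rw [hdc] at this
          exact hv0 σ this
        obtain ⟨u, p, hp, hl⟩ := exists_cycle_of_perm G (c σ) (hc σ) h3 hprod
        exact hG u p hp (by rw [hl]; exact he)
      rw [h2, h1, h0]; simp
    · rw [h2, ho.neg_one_pow]; ring
  have hcard : ∀ σ, (g σ).1.support.card = σ.1.support.card := by
    intro σ
    conv_rhs => rw [← hdc σ]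
    change (d σ * (c σ)⁻¹).support.card = _
    rw [(hdis σ).card_support_mul, (hdis' σ).card_support_mul, support_inv]
  refine Finset.sum_involution (fun σ _ => g σ) ?_ ?_ ?_ ?_
  · intro σ _
    rw [hcard, ← add_mul, ← C_add, hsum]; simp
  · intro σ _ hne heq
    have := hsum σ
    rw [heq] at this
    have h0 : permWt S σ.1 = 0 := by linarith
    exact hne (by rw [h0]; simp)
  · intro σ _; exact Finset.mem_univ _
  · intro σ _; exact hgg σ

lemma forward_dir (G : SimpleGraph V) (S : Matrix V V ℝ) (hS : ∀ a b, S a b = - S b a)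
    (hadj : ∀ a b, S a b ≠ 0 → G.Adj a b) (hone : ∀ a b, G.Adj a b → S a b * S a b = 1)
    (hG : ∀ (u : V) (c : G.Walk u u), c.IsCycle → ¬ Even c.length) :
    S.charpoly = posMatch G := by
  classical
  have hd : ∀ v, S v v = 0 := fun v => by have := hS v v; linarith
  rw [charpoly_eq_sum_permWt S hd, posMatch_eq]
  rw [← Fintype.sum_subtype_add_sum_subtype (fun σ : Perm V => ∀ v, σ (σ v) = v),
    noninvol_sum G S hS hadj hG, add_zero]
  rw [← Finset.sum_subtype (Finset.univ.filter fun σ : Perm V => ∀ v, σ (σ v) = v) (by simp)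
    (fun σ => C (permWt S σ) * X ^ (Fintype.card V - σ.support.card))]
  rw [← Finset.sum_subtype (Finset.univ.filter fun σ : Perm V => (∀ v, σ (σ v) = v) ∧
    (∀ v ∈ σ.support, G.Adj (σ v) v)) (by simp)
    (fun σ => (X : Polynomial ℝ) ^ (Fintype.card V - σ.support.card))]
  symm
  refine (Finset.sum_congr rfl fun σ hσ => ?_).trans (Finset.sum_subset ?_ ?_)
  · obtain ⟨-, h1, h2⟩ := Finset.mem_filter.1 hσ
    rw [permWt_invol S hS σ h1 (fun v hv => hone _ _ (h2 v hv))]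
    simp
  · intro σ hσ
    simp only [Finset.mem_filter, Finset.mem_univ, true_and] at hσ ⊢
    exact hσ.1
  · intro σ h1 h2
    simp only [Finset.mem_filter, Finset.mem_univ, true_and] at h1 h2
    have h3 : ¬ ∀ v ∈ σ.support, G.Adj (σ v) v := fun h => h2 ⟨h1, h⟩
    push Not at h3
    obtain ⟨v, hv, hn⟩ := h3
    have h0 : S (σ v) v = 0 := by
      by_contra h
      exact hn (hadj _ _ h)
    have : permWt S σ = 0 := by
      unfold permWt
      rw [Finset.prod_eq_zero hv (by rw [h0]; simp), mul_zero]
    rw [this]; simp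

/-- Resigning a matrix by a sign on each unordered pair. -/
def resign (S : Matrix V V ℝ) (ε : Sym2 V → ℤˣ) : Matrix V V ℝ :=
  fun a b => ((ε s(a, b) : ℤ) : ℝ) * S a b

lemma permWt_toggle (S : Matrix V V ℝ) (ε : Sym2 V → ℤˣ) (e : Sym2 V) (σ : Perm V) :
    permWt (resign S (ε * Pi.mulSingle e (-1))) σ =
      (-1) ^ (σ.support.filter (fun v => s(v, σ v) = e)).card * permWt (resign S ε) σ := by
  unfold permWt
  have : ∀ v ∈ σ.support, -resign S (ε * Pi.mulSingle e (-1)) (σ v) v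
      = (if s(v, σ v) = e then (-1 : ℝ) else 1) * -resign S ε (σ v) v := by
    intro v _
    unfold resign
    rw [Sym2.eq_swap (a := v)]
    by_cases h : s(σ v, v) = e
    · rw [if_pos h, ← h]; simp
    · rw [if_neg h, Pi.mul_apply, Pi.mulSingle_eq_of_ne h]; simp
  rw [Finset.prod_congr rfl this, Finset.prod_mul_distrib, Finset.prod_ite]
  simp only [Finset.prod_const, one_pow, mul_one]
  ring

lemma sum_eq_zero_of_toggle (F : (Sym2 V → ℤˣ) → ℝ) (e : Sym2 V)
    (h : ∀ ε, F (ε * Pi.mulSingle e (-1)) = - F ε) : ∑ ε, F ε = 0 := by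
  have h1 := Equiv.sum_comp (Equiv.mulRight (Pi.mulSingle e (-1) : Sym2 V → ℤˣ)) F
  simp only [Equiv.coe_mulRight, h, Finset.sum_neg_distrib] at h1
  linarith

lemma cycle_edge_inj {τ : Perm V} (hτ : τ.IsCycle) (h3 : 3 ≤ τ.support.card) {v w : V}
    (hw : w ∈ τ.support) (h : s(v, τ v) = s(w, τ w)) : v = w := by
  rw [Sym2.eq_iff] at h
  rcases h with ⟨h, -⟩ | ⟨h1, h2⟩
  · exact h
  · exfalso
    rw [h1] at h2
    have : τ ^ 2 = 1 := hτ.pow_eq_one_iff.2 ⟨w, mem_support.1 hw, by simpa [pow_two] using h2⟩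
    have := orderOf_le_of_pow_eq_one (by norm_num) this
    rw [hτ.orderOf] at this
    omega

lemma cycle_edge_count {τ : Perm V} (hτ : τ.IsCycle) (h3 : 3 ≤ τ.support.card) {w : V}
    (hw : w ∈ τ.support) : (τ.support.filter (fun v => s(v, τ v) = s(w, τ w))).card = 1 := by
  rw [Finset.card_eq_one]
  refine ⟨w, ?_⟩
  ext v
  simp only [Finset.mem_filter, Finset.mem_singleton]
  constructor
  · rintro ⟨-, h⟩
    exact cycle_edge_inj hτ h3 hw h
  · rintro rfl
    exact ⟨hw, rfl⟩

lemma eq_or_eq_inv_of_edges {σ τ : Perm V} (hτ : τ.IsCycle) (h3 : 3 ≤ τ.support.card)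
    (hc : σ.support.card = τ.support.card)
    (h : ∀ w ∈ τ.support, ∃ v ∈ σ.support, s(v, σ v) = s(w, τ w)) : σ = τ ∨ σ = τ⁻¹ := by
  have hsub : permEdges τ ⊆ permEdges σ := by
    intro e he
    obtain ⟨w, hw, rfl⟩ := Finset.mem_image.1 he
    obtain ⟨v, hv, hvw⟩ := h w hw
    exact Finset.mem_image.2 ⟨v, hv, hvw⟩
  have hct : (permEdges τ).card = τ.support.card :=
    Finset.card_image_of_injOn (fun v _ w hw h => cycle_edge_inj hτ h3 hw h)
  have hle : (permEdges σ).card ≤ σ.support.card := Finset.card_image_le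
  have heq : permEdges τ = permEdges σ := Finset.eq_of_subset_of_card_le hsub (by omega)
  have hcs : (permEdges σ).card = σ.support.card := by rw [← heq, hct, hc]
  have hinj : Set.InjOn (fun v => s(v, σ v)) σ.support := Finset.card_image_iff.1 hcs
  have hcases : ∀ v ∈ σ.support, ∃ w ∈ τ.support, s(w, τ w) = s(v, σ v) := by
    intro v hv
    have : s(v, σ v) ∈ permEdges τ := by rw [heq]; exact Finset.mem_image_of_mem _ hv
    exact Finset.mem_image.1 this
  have hss : σ.support ⊆ τ.support := by
    intro v hv
    obtain ⟨w, hw, he⟩ := hcases v hv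
    rw [Sym2.eq_iff] at he
    rcases he with ⟨h, -⟩ | ⟨-, h⟩
    · rwa [← h]
    · rw [← h]; exact apply_mem_support.2 hw
  have hse : σ.support = τ.support := Finset.eq_of_subset_of_card_le hss hc.ge
  have hdich : ∀ v ∈ τ.support, σ v = τ v ∨ τ (σ v) = v := by
    intro v hv
    obtain ⟨w, hw, he⟩ := hcases v (hse ▸ hv)
    rw [Sym2.eq_iff] at he
    rcases he with ⟨h, h'⟩ | ⟨h, h'⟩
    · left; rw [← h', h]
    · right; rw [← h, h']
  by_cases hex : ∃ v ∈ τ.support, σ v = τ v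
  · left
    obtain ⟨x, hx, hxe⟩ := hex
    have hall : ∀ n : ℕ, σ ((τ ^ n) x) = τ ((τ ^ n) x) := by
      intro n
      induction n with
      | zero => simpa using hxe
      | succ n ih =>
        have hm : (τ ^ n) x ∈ τ.support := pow_apply_mem_support.2 hx
        have hm' : τ ((τ ^ n) x) ∈ τ.support := apply_mem_support.2 hm
        rw [pow_succ', Perm.mul_apply]
        refine (hdich _ hm').resolve_right ?_
        intro hb
        have hb' := τ.injective hb
        have := hinj (hse ▸ hm') (hse ▸ hm) (by
          change s(_, _) = s(_, _)
          rw [hb', ih, Sym2.eq_swap])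
        exact (mem_support.1 hm) this
    ext v
    by_cases hv : v ∈ τ.support
    · obtain ⟨n, hn⟩ := hτ.exists_pow_eq (mem_support.1 hx) (mem_support.1 hv)
      rw [← hn]; exact hall n
    · rw [notMem_support.1 hv, notMem_support.1 (hse ▸ hv)]
  · right
    push Not at hex
    ext v
    rw [Perm.eq_inv_iff_eq]
    by_cases hv : v ∈ τ.support
    · exact (hdich v hv).resolve_left (hex v hv)
    · rw [notMem_support.1 (hse ▸ hv : v ∉ σ.support), notMem_support.1 hv]

lemma backward_dir (G : SimpleGraph V) (S : Matrix V V ℝ) (hS : ∀ a b, S a b = - S b a)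
    (hone : ∀ a b, G.Adj a b → S a b ≠ 0) (P : Polynomial ℝ)
    (H : ∀ ε : Sym2 V → ℤˣ, (resign S ε).charpoly = P)
    (u : V) (p : G.Walk u u) (hp : p.IsCycle) : ¬ Even p.length := by
  intro hev
  obtain ⟨τ, hτ, hcard, hadj⟩ := exists_perm_of_cycle G u p hp
  have h3 : 3 ≤ τ.support.card := hcard ▸ hp.three_le_length
  rw [← hcard] at hev
  have hSε : ∀ ε a b, resign S ε a b = - resign S ε b a := by
    intro ε a b
    unfold resign
    rw [hS a b, Sym2.eq_swap]; ring
  have hdε : ∀ ε v, resign S ε v v = 0 := fun ε v => by have := hSε ε v v; linarith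
  have hne : ∀ ε, permWt (resign S ε) τ ≠ 0 := by
    intro ε
    unfold permWt
    refine mul_ne_zero (by simp) (Finset.prod_ne_zero_iff.2 fun v hv => neg_ne_zero.2 ?_)
    exact mul_ne_zero (by simp) (hone _ _ (hadj v hv).symm)
  have hl : τ.support.card ≤ Fintype.card V := Finset.card_le_univ _
  obtain ⟨x, hx, -⟩ := id hτ
  have hx' := mem_support.2 hx
  have hzero : ∑ ε : Sym2 V → ℤˣ, permWt (resign S ε) τ = 0 := by
    refine sum_eq_zero_of_toggle _ s(x, τ x) fun ε => ?_
    rw [permWt_toggle, cycle_edge_count hτ h3 hx']; ring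
  have hT : ∑ σ ∈ Finset.univ.filter (fun σ : Perm V => σ.support.card = τ.support.card),
      ∑ ε : Sym2 V → ℤˣ, permWt (resign S ε) τ * permWt (resign S ε) σ = 0 := by
    rw [Finset.sum_comm]
    have : ∀ ε ∈ (Finset.univ : Finset (Sym2 V → ℤˣ)),
        ∑ σ ∈ Finset.univ.filter (fun σ : Perm V => σ.support.card = τ.support.card),
          permWt (resign S ε) τ * permWt (resign S ε) σ
        = permWt (resign S ε) τ * P.coeff (Fintype.card V - τ.support.card) := by
      intro ε _
      rw [← Finset.mul_sum, ← coeff_charpoly_eq _ (hdε ε) _ hl, H]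
    rw [Finset.sum_congr rfl this, ← Finset.sum_mul, hzero, zero_mul]
  have hpos : 0 < ∑ ε : Sym2 V → ℤˣ, permWt (resign S ε) τ * permWt (resign S ε) τ :=
    Finset.sum_pos (fun ε _ => mul_self_pos.2 (hne ε)) Finset.univ_nonempty
  have hnn : ∀ σ ∈ Finset.univ.filter (fun σ : Perm V => σ.support.card = τ.support.card),
      0 ≤ ∑ ε : Sym2 V → ℤˣ, permWt (resign S ε) τ * permWt (resign S ε) σ := by
    intro σ hσ
    have hc := (Finset.mem_filter.1 hσ).2
    by_cases hex : ∃ w ∈ τ.support,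
        Even (σ.support.filter (fun v => s(v, σ v) = s(w, τ w))).card
    · obtain ⟨w, hw, he⟩ := hex
      refine ge_of_eq (sum_eq_zero_of_toggle _ s(w, τ w) fun ε => ?_)
      rw [permWt_toggle, permWt_toggle, cycle_edge_count hτ h3 hw, he.neg_one_pow]; ring
    · push Not at hex
      have : σ = τ ∨ σ = τ⁻¹ := by
        refine eq_or_eq_inv_of_edges hτ h3 hc fun w hw => ?_
        have h1 : (σ.support.filter (fun v => s(v, σ v) = s(w, τ w))).Nonempty := by
          rw [Finset.nonempty_iff_ne_empty]
          intro h0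
          apply hex w hw
          rw [h0]; simp
        obtain ⟨v, hv⟩ := h1
        exact ⟨v, (Finset.mem_filter.1 hv).1, (Finset.mem_filter.1 hv).2⟩
      rcases this with rfl | rfl
      · exact hpos.le
      · refine Finset.sum_nonneg fun ε _ => ?_
        rw [permWt_inv _ (hSε ε), hev.neg_one_pow, one_mul]
        exact mul_self_nonneg _
  have := (Finset.sum_eq_zero_iff_of_nonneg hnn).1 hT τ (by simp)
  linarith

end aux

/-- `G` has no even cycle iff for every orientation `σ` of `G` the characteristic
polynomial of the skew-adjacency matrix satisfies `φ_s(G^σ, x) = (-i)^n · m(G, i·x)`. -/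
theorem no_even_cycle_iff_skew_charpoly {V : Type*} [Fintype V] [DecidableEq V]
    (G : SimpleGraph V) :
    (∀ (u : V) (c : G.Walk u u), c.IsCycle → ¬ Even c.length) ↔
      (∀ o : V → V → Bool,
        (∀ a b, o a b = true → G.Adj a b) →
        (∀ a b, G.Adj a b → (o a b = !o b a)) →
        ((skewMatrix o).map (fun x : ℝ => (x : ℂ))).charpoly =
          Polynomial.C ((-Complex.I) ^ Fintype.card V) *
            ((matchPoly G).map (algebraMap ℝ ℂ)).comp
              (Polynomial.C Complex.I * Polynomial.X)) := by
  rw [rhs_eq]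
  have hred : ∀ o : V → V → Bool,
      (((skewMatrix o).map (fun x : ℝ => (x : ℂ))).charpoly
        = (posMatch G).map (algebraMap ℝ ℂ)) ↔ (skewMatrix o).charpoly = posMatch G := by
    intro o
    have : (skewMatrix o).map (fun x : ℝ => (x : ℂ)) = (skewMatrix o).map (algebraMap ℝ ℂ) := rfl
    rw [this, Matrix.charpoly_map]
    exact (Polynomial.map_injective _ (algebraMap ℝ ℂ).injective).eq_iff
  simp only [hred]
  have hskew : ∀ o : V → V → Bool, (∀ a b, o a b = true → G.Adj a b) →
      (∀ a b, G.Adj a b → (o a b = !o b a)) →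
      (∀ a b, skewMatrix o a b = - skewMatrix o b a) ∧
      (∀ a b, skewMatrix o a b ≠ 0 → G.Adj a b) ∧
      (∀ a b, G.Adj a b → skewMatrix o a b * skewMatrix o a b = 1) := by
    intro o h1 h2
    refine ⟨fun a b => ?_, fun a b h => ?_, fun a b h => ?_⟩
    · unfold skewMatrix
      cases hab : o a b
      · cases hba : o b a <;> simp
      · have := h2 a b (h1 a b hab)
        rw [hab] at this
        cases hba : o b a
        · simp
        · rw [hba] at this; simp at this
    · unfold skewMatrix at h
      cases hab : o a b
      · cases hba : o b a
        · simp [hab, hba] at h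
        · exact (h1 _ _ hba).symm
      · exact h1 _ _ hab
    · have := h2 a b h
      unfold skewMatrix
      cases hba : o b a <;> simp [hba] at this <;> simp [this]
  constructor
  · intro hG o h1 h2
    obtain ⟨ha, hb, hc⟩ := hskew o h1 h2
    exact forward_dir G _ ha hb hc hG
  · intro H
    classical
    let φ := Fintype.equivFin V
    let o : V → V → Bool := fun a b => decide (G.Adj a b ∧ φ a < φ b)
    have h1 : ∀ a b, o a b = true → G.Adj a b := fun a b h => (of_decide_eq_true h).1
    have h2 : ∀ a b, G.Adj a b → (o a b = !o b a) := by
      intro a b h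
      have hne : φ a ≠ φ b := fun h' => h.ne (φ.injective h')
      rcases lt_or_gt_of_ne hne with hlt | hlt
      · simp [o, h, h.symm, hlt, hlt.le]
      · simp [o, h, h.symm, hlt, hlt.le]
    obtain ⟨ha, hb, hc⟩ := hskew o h1 h2
    refine backward_dir G (skewMatrix o) ha
      (fun a b h h0 => by have := hc a b h; rw [h0] at this; simp at this) (posMatch G) ?_
    intro ε
    have key : resign (skewMatrix o) ε
        = skewMatrix (fun a b => if ε s(a, b) = 1 then o a b else o b a) := by
      ext a b
      rcases Int.units_eq_one_or (ε s(a, b)) with he | he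
      · have he' : ε s(b, a) = 1 := by rw [Sym2.eq_swap]; exact he
        simp [resign, skewMatrix, he, he']
      · have he' : ε s(b, a) = -1 := by rw [Sym2.eq_swap]; exact he
        have := ha a b
        have hn : (-1 : ℤˣ) ≠ 1 := by decide
        simp only [resign, he]
        rw [this]
        simp [skewMatrix, he, he', hn]
        split_ifs <;> simp
    rw [key]
    apply H
    · intro a b h
      split_ifs at h
      · exact h1 _ _ h
      · exact (h1 _ _ h).symm
    · intro a b h
      rw [Sym2.eq_swap (a := b)]
      split_ifs
      · exact h2 _ _ h
      · exact h2 _ _ h.symm
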